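/- arXiv:1509.01508 — 5 statements merged into one kernel-verified Lean document; each statement's English description precedes it below -/
import Mathlib

section
/- Let X be a locally compact metric space, let G be a group acting on X by homeomorphisms, let F ⊆ G be a finite subset and let n ∈ ℕ. If a compact subset E ⊆ X is (F,n)-disjoint, then there exists an open, relatively compact neighbourhood V of E such that the closure of V is (F,n)-disjoint. -/
open Pointwise

/-- A set `E ⊆ X` is `(M, k)`-disjoint (for a group `G` acting on `X`) if for all pairwise
distinct elements `γ 0, …, γ k` of `M`, the intersection `γ 0 • E ∩ ⋯ ∩ γ k • E` is empty. -/
def SmulDisjoint {G X : Type*} [Group G] [MulAction G X]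
    (M : Set G) (k : ℕ) (E : Set X) : Prop :=
  ∀ γ : Fin (k + 1) → G, (∀ i, γ i ∈ M) → Function.Injective γ →
    (⋂ i, γ i • E) = (∅ : Set X)

open Filter Topology Metric

theorem SmulDisjoint.mono {G X : Type*} [Group G] [MulAction G X] {M : Set G} {k : ℕ}
    {E E' : Set X} (hE' : SmulDisjoint M k E') (h : E ⊆ E') : SmulDisjoint M k E :=
  fun γ hγ hinj => Set.subset_eq_empty (Set.iInter_mono fun _ => Set.smul_set_mono h)
    (hE' γ hγ hinj)

/-- If finitely many translates of a compact set have no common point, then neither do the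
corresponding translates of its sufficiently small closed thickenings. -/
theorem IsCompact.eventually_iInter_smul_cthickening_eq_empty {G X ι : Type*} [Group G]
    [MetricSpace X] [LocallyCompactSpace X] [MulAction G X] [ContinuousConstSMul G X]
    [Nonempty ι] {E : Set X} (hE : IsCompact E) (γ : ι → G)
    (h : (⋂ i, γ i • E) = (∅ : Set X)) :
    ∀ᶠ δ in 𝓝[>] (0 : ℝ), (⋂ i, γ i • cthickening δ E) = (∅ : Set X) := by
  obtain ⟨δ₀, hδ₀, hK⟩ := hE.exists_isCompact_cthickening
  obtain ⟨i₀⟩ := ‹Nonempty ι›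
  have mono {δ δ' : ℝ} (hle : δ ≤ δ') :
      (⋂ i, γ i • cthickening δ E) ⊆ ⋂ i, γ i • cthickening δ' E :=
    Set.iInter_mono fun _ => Set.smul_set_mono (cthickening_mono hle E)
  have : Nonempty (Set.Ioi (0 : ℝ)) := ⟨⟨δ₀, hδ₀⟩⟩
  have hK₀ : IsCompact (γ i₀ • cthickening δ₀ E) := hK.smul (γ i₀)
  obtain ⟨⟨δ₁, hδ₁⟩, hempty⟩ := hK₀.elim_directed_family_closed
    (fun δ : Set.Ioi (0 : ℝ) => ⋂ i, γ i • cthickening (δ : ℝ) E)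
    (fun _ => isClosed_iInter fun i => isClosed_cthickening.smul (γ i))
    (by
      refine Set.eq_empty_of_subset_empty fun x hx => ?_
      rw [← h, Set.mem_iInter]
      intro i
      rw [Set.mem_smul_set_iff_inv_smul_mem, ← hE.isClosed.closure_eq,
        closure_eq_iInter_cthickening]
      simp only [Set.mem_iInter]
      intro δ hδ
      rw [← Set.mem_smul_set_iff_inv_smul_mem]
      exact Set.mem_iInter.1 (Set.mem_iInter.1 hx.2 ⟨δ, hδ⟩) i)
    (fun a b => ⟨⟨min a b, Set.mem_Ioi.2 (lt_min a.2 b.2)⟩, 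
      mono (min_le_left _ _), mono (min_le_right _ _)⟩)
  filter_upwards [Ioo_mem_nhdsGT (lt_min hδ₀ hδ₁)] with δ hδ
  refine Set.subset_eq_empty (Set.subset_inter ?_ (mono ?_)) hempty
  · exact (Set.iInter_subset _ i₀).trans
      (Set.smul_set_mono (cthickening_mono (hδ.2.le.trans (min_le_left _ _)) E))
  · exact hδ.2.le.trans (min_le_right _ _)

/-- If a compact subset `E` of a locally compact metric space acted on by homeomorphisms is
`(F, n)`-disjoint for a finite set `F` of group elements, then `E` has an open relatively
compact neighbourhood whose closure is still `(F, n)`-disjoint. -/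
theorem exists_relativelyCompact_nhd_smulDisjoint
    {G X : Type*} [Group G] [MetricSpace X] [LocallyCompactSpace X]
    [MulAction G X] [ContinuousConstSMul G X]
    (F : Finset G) (n : ℕ) (E : Set X) (hE : IsCompact E)
    (hdisj : SmulDisjoint (F : Set G) n E) :
    ∃ V : Set X, IsOpen V ∧ E ⊆ V ∧ IsCompact (closure V) ∧
      SmulDisjoint (F : Set G) n (closure V) := by
  have hsmall : ∀ᶠ δ in 𝓝[>] (0 : ℝ), SmulDisjoint (F : Set G) n (cthickening δ E) := by
    have hall : ∀ᶠ δ in 𝓝[>] (0 : ℝ), ∀ γ : Fin (n + 1) → F,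
        Function.Injective γ → (⋂ i, (γ i : G) • cthickening δ E) = (∅ : Set X) := by
      refine eventually_all.2 fun γ => ?_
      by_cases hγ : Function.Injective γ
      · filter_upwards [hE.eventually_iInter_smul_cthickening_eq_empty (fun i => (γ i : G))
          (hdisj _ (fun i => (γ i).2) (Subtype.val_injective.comp hγ))] with δ hδ _ using hδ
      · exact Eventually.of_forall fun _ h => absurd h hγ
    filter_upwards [hall] with δ hδ γ hγ hinj
    exact hδ (fun i => ⟨γ i, hγ i⟩) fun i j hij => hinj (congrArg Subtype.val hij)
  obtain ⟨δ₀, hδ₀, hK⟩ := hE.exists_isCompact_cthickening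
  obtain ⟨δ, hδ, hpos, hlt⟩ := (hsmall.and (Ioo_mem_nhdsGT hδ₀)).exists
  exact ⟨thickening δ E, isOpen_thickening, self_subset_thickening hpos E,
    hK.of_isClosed_subset isClosed_closure
      ((closure_thickening_subset_cthickening δ E).trans (cthickening_mono hlt.le E)),
    hδ.mono (closure_thickening_subset_cthickening δ E)⟩
end

section
/- Let X be a locally compact metric space and let E ⊆ X be a subset with the following property: for every point x ∈ X and every open neighbourhood U of x there exists an open set U' with x ∈ U' ⊆ U and ∂U' ∩ E = ∅. Then for every compact set K ⊆ X and every open set V ⊇ K there exists a relatively compact open set U with K ⊆ U ⊆ closure(U) ⊆ V and ∂U ∩ E = ∅. -/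
/-- In a locally compact metric space, if `E` is a set such that every point has arbitrarily
small open neighbourhoods whose boundary misses `E` (as is the case for zero-dimensional `E`),
then every compact set `K` contained in an open set `V` admits a relatively compact open set
`U` with `K ⊆ U ⊆ closure U ⊆ V` and `∂U ∩ E = ∅`. -/
theorem exists_relativelyCompact_open_frontier_avoiding
    {X : Type*} [MetricSpace X] [LocallyCompactSpace X] (E : Set X)
    (hE : ∀ x : X, ∀ U : Set X, IsOpen U → x ∈ U →
      ∃ U' : Set X, IsOpen U' ∧ x ∈ U' ∧ U' ⊆ U ∧ frontier U' ∩ E = ∅)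
    (K V : Set X) (hK : IsCompact K) (hV : IsOpen V) (hKV : K ⊆ V) :
    ∃ U : Set X, IsOpen U ∧ IsCompact (closure U) ∧ K ⊆ U ∧ closure U ⊆ V ∧
      frontier U ∩ E = ∅ := by
  obtain ⟨W, hW, hKW, hWV, hWc⟩ := exists_open_between_and_isCompact_closure hK hV hKV
  obtain ⟨U, hU, hKU, hUW, hUE⟩ :
      ∃ U : Set X, IsOpen U ∧ K ⊆ U ∧ U ⊆ W ∧ frontier U ∩ E = ∅ := by
    refine hK.induction_on
      (p := fun s ↦ ∃ U : Set X, IsOpen U ∧ s ⊆ U ∧ U ⊆ W ∧ frontier U ∩ E = ∅) ?_ ?_ ?_ ?_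
    · exact ⟨∅, isOpen_empty, subset_rfl, Set.empty_subset W, by simp⟩
    · rintro s t hst ⟨U, hU, htU, hUW, hUE⟩
      exact ⟨U, hU, hst.trans htU, hUW, hUE⟩
    · rintro s t ⟨U₁, hU₁, hsU₁, hU₁W, hU₁E⟩ ⟨U₂, hU₂, htU₂, hU₂W, hU₂E⟩
      refine ⟨U₁ ∪ U₂, hU₁.union hU₂, Set.union_subset_union hsU₁ htU₂,
        Set.union_subset hU₁W hU₂W, ?_⟩
      rw [← Set.subset_empty_iff]
      rintro x ⟨hx, hxE⟩
      rcases frontier_union_subset U₁ U₂ hx with h | h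
      · exact hU₁E.subset ⟨h.1, hxE⟩
      · exact hU₂E.subset ⟨h.2, hxE⟩
    · intro x hx
      obtain ⟨U, hU, hxU, hUW, hUE⟩ := hE x W hW (hKW hx)
      exact ⟨U, mem_nhdsWithin_of_mem_nhds (hU.mem_nhds hxU), U, hU, subset_rfl, hUW, hUE⟩
  exact ⟨U, hU, hWc.of_isClosed_subset isClosed_closure (closure_mono hUW), hKU,
    (closure_mono hUW).trans hWV, hUE⟩
end

section
/- Let X be a locally compact metric space, let G be a group acting on X by homeomorphisms, let M ⊆ G be a finite subset and let d ∈ ℕ. Let U ⊆ X be a relatively compact open set whose boundary ∂U is (M,d)-disjoint, and let R ⊆ X be a compact set with R ∩ α_g(U) = ∅ for every g ∈ M. Then there exists δ > 0 such that for every x ∈ R, the number of elements g ∈ M with α_g(closure(U)) ∩ closed-ball(x,δ) ≠ ∅ is at most d. -/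
open Pointwise

/-- A point outside all the translates `g • U` of an open set `U` with `(M, d)`-disjoint boundary
lies in at most `d` of the translates `g • closure U`. -/
theorem SmulDisjoint.ncard_mem_smul_closure_le {G X : Type*} [Group G] [TopologicalSpace X]
    [MulAction G X] {M : Set G} (hM : M.Finite) {d : ℕ} {U : Set X} (hU : IsOpen U)
    (hbd : SmulDisjoint M d (frontier U)) {x : X} (hx : ∀ g ∈ M, x ∉ g • U) :
    {g ∈ M | x ∈ g • closure U}.ncard ≤ d := by
  by_contra! h
  have hfin : {g ∈ M | x ∈ g • closure U}.Finite := hM.subset (Set.sep_subset _ _)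
  obtain ⟨T, hTsub, hTcard⟩ := Set.exists_subset_card_eq (Nat.succ_le_of_lt h)
  have hT : T.Finite := hfin.subset hTsub
  have : Fintype T := hT.fintype
  have e : Fin (d + 1) ≃ T := (Fintype.equivFinOfCardEq (by
    rw [← Nat.card_eq_fintype_card, Nat.card_coe_set_eq, hTcard])).symm
  have hmem : x ∈ ⋂ i, (e i : G) • frontier U := by
    refine Set.mem_iInter.2 fun i => ?_
    obtain ⟨hi, hxi⟩ := hTsub (e i).2
    rw [hU.frontier_eq, Set.smul_set_sdiff]
    exact ⟨hxi, hx _ hi⟩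
  rw [hbd (fun i => e i) (fun i => (hTsub (e i).2).1)
    (Subtype.val_injective.comp e.injective)] at hmem
  exact hmem

/-- If `x` is not in the closed set `C`, then closed balls of small radius around points near `x`
do not meet `C`. -/
theorem IsClosed.eventually_not_nonempty_inter_closedBall {X : Type*} [PseudoMetricSpace X]
    {C : Set X} (hC : IsClosed C) {x : X} (hx : x ∉ C) :
    ∀ᶠ z : ℝ × X in nhds (0, x), ¬ (C ∩ Metric.closedBall z.2 z.1).Nonempty := by
  obtain ⟨ε, hε, hball⟩ := Metric.isOpen_iff.1 hC.isOpen_compl x hx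
  have hlim : Filter.Tendsto (fun z : ℝ × X => z.1 + dist z.2 x) (nhds (0, x)) (nhds 0) := by
    have hcont : Continuous fun z : ℝ × X => z.1 + dist z.2 x := by fun_prop
    simpa using hcont.tendsto (0, x)
  filter_upwards [hlim.eventually_lt_const hε] with z hz
  rintro ⟨y, hyC, hy⟩
  refine hball (Metric.mem_ball.2 ?_) hyC
  linarith [dist_triangle y z.2 x, Metric.mem_closedBall.1 hy]

/-- Let `U` be a relatively compact open set whose boundary is `(M, d)`-disjoint, and let `R`
be a compact set disjoint from all the translates `g • U`, `g ∈ M`. Then for some `δ > 0`,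
every point of `R` has its closed `δ`-ball meeting at most `d` of the translates
`g • closure U`, `g ∈ M`. -/
theorem exists_delta_card_translates_le
    {G X : Type*} [Group G] [MetricSpace X] [LocallyCompactSpace X]
    [MulAction G X] [ContinuousConstSMul G X]
    (M : Finset G) (d : ℕ) (U : Set X) (hUopen : IsOpen U) (hUc : IsCompact (closure U))
    (hbd : SmulDisjoint (M : Set G) d (frontier U))
    (R : Set X) (hR : IsCompact R) (hRU : ∀ g ∈ M, R ∩ g • U = ∅) :
    ∃ δ : ℝ, 0 < δ ∧ ∀ x ∈ R,
      {g ∈ (M : Set G) | ((g • closure U) ∩ Metric.closedBall x δ).Nonempty}.ncard ≤ d := by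
  have hev : ∀ᶠ δ : ℝ in nhds 0, ∀ x ∈ R,
      {g ∈ (M : Set G) | ((g • closure U) ∩ Metric.closedBall x δ).Nonempty}.ncard ≤ d := by
    refine hR.eventually_forall_of_forall_eventually fun x hx => ?_
    have hfar : ∀ᶠ z : ℝ × X in nhds (0, x), ∀ g ∈ M, x ∉ g • closure U →
        ¬ ((g • closure U) ∩ Metric.closedBall z.2 z.1).Nonempty := by
      refine (Filter.eventually_all_finset M).2 fun g _ => Filter.eventually_imp_distrib_left.2 ?_
      exact (isClosed_closure.smul g).eventually_not_nonempty_inter_closedBall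
    filter_upwards [hfar] with z hz
    refine le_trans (Set.ncard_le_ncard ?_ (M.finite_toSet.subset (Set.sep_subset _ _)))
      (hbd.ncard_mem_smul_closure_le M.finite_toSet hUopen (x := x)
        fun g hg hxg => (hRU g hg).le ⟨hx, hxg⟩)
    rintro g ⟨hg, hne⟩
    exact ⟨hg, by_contra fun h => hz g hg h hne⟩
  obtain ⟨ε, hε, hball⟩ := Metric.eventually_nhds_iff.1 hev
  refine ⟨ε / 2, half_pos hε, hball ?_⟩
  rw [Real.dist_0_eq_abs, abs_of_pos (half_pos hε)]
  exact half_lt_self hε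
end

section
/- Let X be a locally compact metric space and let h : X → X be a homeomorphism generating an action of ℤ on X. Let m, d ∈ ℕ with m ≥ 1, set N = (d+1)(4m+1) and M = {1,2,…,N} ⊆ ℤ. Suppose that every orbit {hⁿ(x) : n ∈ ℤ} has cardinality strictly greater than N, and that (X,h,ℤ) has the (M,d)-small boundary property. Then for every compact subset K ⊆ X there exists an open set Z ⊆ X such that (a) the sets h^{-m}(closure(Z)), …, h^{0}(closure(Z)), …, h^{m}(closure(Z)) are pairwise disjoint, and (b) K ⊆ ⋃_{i=1}^{N} h^{i}(Z). -/
/-- For a homeomorphism generating a `ℤ`-action (given here by the permutation `e`, iterated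
via integer powers), a set `E ⊆ X` is `(M, k)`-disjoint, for `M ⊆ ℤ`, if for all pairwise
distinct `γ 0, …, γ k ∈ M` the intersection `e^(γ 0) '' E ∩ ⋯ ∩ e^(γ k) '' E` is empty. -/
def IterDisjoint {X : Type*} (e : Equiv.Perm X) (M : Set ℤ) (k : ℕ) (E : Set X) : Prop :=
  ∀ γ : Fin (k + 1) → ℤ, (∀ i, γ i ∈ M) → Function.Injective γ →
    (⋂ i, (e ^ γ i) '' E) = (∅ : Set X)

/-- The system `(X, h, ℤ)` has the `(M, d)`-small boundary property if every compact set
contained in an open set `V` admits a relatively compact open neighbourhood `U ⊆ V` whose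
boundary is `(M, d)`-disjoint. -/
def ZSmallBoundaryProperty {X : Type*} [TopologicalSpace X] (e : Equiv.Perm X)
    (M : Set ℤ) (d : ℕ) : Prop :=
  ∀ K : Set X, IsCompact K → ∀ V : Set X, IsOpen V → K ⊆ V →
    ∃ U : Set X, IsOpen U ∧ IsCompact (closure U) ∧ K ⊆ U ∧ U ⊆ V ∧
      IterDisjoint e M d (frontier U)

/-- The set `L` contains no two points that differ by an iterate of `e` with exponent in `J`. -/
def ReturnFree {X : Type*} (e : Equiv.Perm X) (J : Set ℤ) (L : Set X) : Prop :=
  ∀ j ∈ J, ∀ x ∈ L, (e ^ j) x ∉ L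

theorem ReturnFree.mono {X : Type*} {e : Equiv.Perm X} {J : Set ℤ} {L L' : Set X}
    (hL : ReturnFree e J L) (hsub : L' ⊆ L) : ReturnFree e J L' :=
  fun j hj x hx hx' => hL j hj x (hsub hx) (hsub hx')

theorem Homeomorph.continuous_toEquiv_zpow {X : Type*} [TopologicalSpace X] (h : X ≃ₜ X) (n : ℤ) :
    Continuous (h.toEquiv ^ n) := by
  have hnat : ∀ (k : X ≃ₜ X) (n : ℕ), Continuous (k.toEquiv ^ n) := by
    intro k n
    induction n with
    | zero => exact continuous_id
    | succ n ih =>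
      rw [pow_succ, Equiv.Perm.coe_mul]
      exact ih.comp k.continuous
  cases n with
  | ofNat n => simpa using hnat h n
  | negSucc n =>
    rw [zpow_negSucc, ← inv_pow]
    exact hnat h.symm (n + 1)

theorem Equiv.Perm.mem_image_zpow {X : Type*} (e : Equiv.Perm X) (n : ℤ) (S : Set X) (x : X) :
    x ∈ (e ^ n) '' S ↔ (e ^ (-n)) x ∈ S := by
  rw [Equiv.image_eq_preimage_symm, zpow_neg]
  rfl

theorem Equiv.Perm.zpow_add_apply {X : Type*} (e : Equiv.Perm X) (a b : ℤ) (x : X) :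
    (e ^ (a + b)) x = (e ^ a) ((e ^ b) x) := by
  rw [zpow_add, Equiv.Perm.mul_apply]

theorem Equiv.Perm.encard_orbit_le_natAbs {X : Type*} (e : Equiv.Perm X) {j : ℤ} (hj : j ≠ 0)
    {x : X} (hx : (e ^ j) x = x) :
    (Set.range fun n : ℤ => (e ^ n) x).encard ≤ (j.natAbs : ℕ∞) := by
  have hsub : (Set.range fun n : ℤ => (e ^ n) x) ⊆
      (fun n : ℕ => (e ^ n) x) '' (Finset.range j.natAbs : Set ℕ) := by
    rintro _ ⟨n, rfl⟩
    have h0 : 0 ≤ n % j := Int.emod_nonneg n hj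
    have h1 : n % j < j.natAbs := (Int.emod_lt_abs n hj).trans_eq (Int.abs_eq_natAbs j)
    refine ⟨(n % j).toNat, by simp only [Finset.coe_range, Set.mem_Iio]; omega, ?_⟩
    have hfix : ((e ^ j) ^ (n / j)) x = x :=
      Equiv.Perm.zpow_apply_eq_self_of_apply_eq_self hx _
    calc (e ^ (n % j).toNat) x = (e ^ (n % j)) x := by
          rw [← zpow_natCast, Int.toNat_of_nonneg h0]
      _ = (e ^ (n % j)) ((e ^ (j * (n / j))) x) := by rw [zpow_mul, hfix]
      _ = (e ^ n) x := by rw [← Equiv.Perm.zpow_add_apply, Int.emod_add_mul_ediv]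
  calc _ ≤ _ := Set.encard_le_encard hsub
    _ ≤ (Finset.range j.natAbs : Set ℕ).encard := Set.encard_image_le _ _
    _ = _ := by rw [Set.encard_coe_eq_coe_finsetCard, Finset.card_range]

theorem ReturnFree.exists_compact_superset {X : Type*} [TopologicalSpace X] [T2Space X]
    [LocallyCompactSpace X] (h : X ≃ₜ X) {J : Set ℤ} (hJ : J.Finite) {L : Set X}
    (hL : IsCompact L) (hfree : ReturnFree h.toEquiv J L) :
    ∃ L' : Set X, IsCompact L' ∧ L ⊆ interior L' ∧ ReturnFree h.toEquiv J L' := by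
  have hsep : ∀ j ∈ J, ∃ O : Set X, IsOpen O ∧ L ⊆ O ∧ ∀ x ∈ O, (h.toEquiv ^ j) x ∉ O := by
    intro j hj
    have hc := h.continuous_toEquiv_zpow j
    have hdisj : Disjoint L ((h.toEquiv ^ j) '' L) := by
      rw [Set.disjoint_right]
      rintro _ ⟨x, hx, rfl⟩
      exact hfree j hj x hx
    obtain ⟨U, V, hU, hV, hLU, hLV, hUV⟩ :=
      SeparatedNhds.of_isCompact_isCompact hL (hL.image hc) hdisj
    exact ⟨U ∩ (h.toEquiv ^ j) ⁻¹' V, hU.inter (hV.preimage hc),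
      Set.subset_inter hLU (Set.image_subset_iff.mp hLV),
      fun x hx hx' => Set.disjoint_left.mp hUV hx'.1 hx.2⟩
  choose! O hO hLO hfreeO using hsep
  obtain ⟨L', hL', hLL', hL'O⟩ := exists_compact_between hL (hJ.isOpen_biInter hO)
    (Set.subset_iInter₂ hLO)
  refine ⟨L', hL', hLL', fun j hj x hx hx' => ?_⟩
  exact hfreeO j hj x (Set.mem_iInter₂.mp (hL'O hx) j hj) (Set.mem_iInter₂.mp (hL'O hx') j hj)

theorem finite_ne_zero_abs_le (n : ℤ) : {j : ℤ | j ≠ 0 ∧ |j| ≤ n}.Finite :=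
  (Set.finite_Icc (-n) n).subset fun _ hj => abs_le.mp hj.2

/-- If the boundary of `U` is `({1, …, (d + 1)(4m + 1)}, d)`-disjoint, then each point lying in no
translate of `U` admits a block of `4m + 1` consecutive exponents along which it also avoids the
translates of `closure U`. -/
theorem IterDisjoint.exists_block_notMem_closure {X : Type*} [TopologicalSpace X]
    {e : Equiv.Perm X} {m d N : ℕ} (hN : N = (d + 1) * (4 * m + 1)) {U : Set X} (hU : IsOpen U)
    (hdisj : IterDisjoint e (Set.Icc (1 : ℤ) N) d (frontier U)) {x : X}
    (hx : ∀ g ∈ Set.Icc (1 : ℤ) N, (e ^ (-g)) x ∉ U) :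
    ∃ k : Fin (d + 1), ∀ i : ℤ, |i| ≤ 2 * m →
      (e ^ (-((k : ℤ) * (4 * m + 1) + 2 * m + 1 + i))) x ∉ closure U := by
  by_contra! hcon
  choose i hi hmem using hcon
  have hiM : ∀ k : Fin (d + 1),
      (k : ℤ) * (4 * m + 1) + 2 * m + 1 + i k ∈ Set.Icc (1 : ℤ) N := by
    intro k
    have h1 := abs_le.mp (hi k)
    have h2 : (k : ℤ) ≤ d := by have := k.isLt; omega
    have h3 : (0 : ℤ) ≤ k := by omega
    have h4 : (k : ℤ) * (4 * m + 1) ≤ d * (4 * m + 1) := by gcongr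
    have h5 : (0 : ℤ) ≤ k * (4 * m + 1) := by positivity
    have h6 : (N : ℤ) = d * (4 * m + 1) + (4 * m + 1) := by rw [hN]; push_cast; ring
    constructor <;> linarith
  have hempty := hdisj (fun k => (k : ℤ) * (4 * m + 1) + 2 * m + 1 + i k) hiM ?_
  · refine Set.eq_empty_iff_forall_notMem.mp hempty x (Set.mem_iInter.mpr fun k => ?_)
    rw [e.mem_image_zpow, hU.frontier_eq]
    exact ⟨hmem k, hx _ (hiM k)⟩
  · intro k l hkl
    have h1 := abs_le.mp (hi k)
    have h2 := abs_le.mp (hi l)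
    have hkl' : (k : ℤ) * (4 * m + 1) + 2 * m + 1 + i k =
      (l : ℤ) * (4 * m + 1) + 2 * m + 1 + i l := hkl
    rcases lt_trichotomy (k : ℤ) l with hlt | heq | hlt
    · nlinarith
    · exact Fin.ext (by exact_mod_cast heq)
    · nlinarith

theorem ReturnFree.exists_compact_superset_covering {X : Type*} [TopologicalSpace X] [T2Space X]
    [LocallyCompactSpace X] (h : X ≃ₜ X) {m d N : ℕ} (hN : N = (d + 1) * (4 * m + 1))
    (hSBP : ZSmallBoundaryProperty h.toEquiv (Set.Icc (1 : ℤ) N) d)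
    {C : Set X} (hC : IsCompact C) (hCfree : ReturnFree h.toEquiv {j : ℤ | j ≠ 0 ∧ |j| ≤ N} C)
    {L : Set X} (hL : IsCompact L)
    (hLfree : ReturnFree h.toEquiv {j : ℤ | j ≠ 0 ∧ |j| ≤ 2 * m} L) :
    ∃ L' : Set X, IsCompact L' ∧ ReturnFree h.toEquiv {j : ℤ | j ≠ 0 ∧ |j| ≤ 2 * m} L' ∧
      L ⊆ L' ∧ C ⊆ ⋃ g ∈ Set.Icc (1 : ℤ) N, (h.toEquiv ^ g) '' L' := by
  set e : Equiv.Perm X := h.toEquiv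
  have hcont : ∀ n : ℤ, Continuous (e ^ n) := h.continuous_toEquiv_zpow
  obtain ⟨O, hO, hLO, hOfree⟩ :=
    ReturnFree.exists_compact_superset h (finite_ne_zero_abs_le _) hL hLfree
  obtain ⟨U, hU, hUc, hLU, hUO, hfr⟩ := hSBP L hL (interior O) isOpen_interior hLO
  have hUfree : ReturnFree e {j : ℤ | j ≠ 0 ∧ |j| ≤ 2 * m} (closure U) :=
    hOfree.mono (closure_minimal (hUO.trans interior_subset) hO.isClosed)
  set c : Fin (d + 1) → ℤ := fun k => (k : ℤ) * (4 * m + 1) + 2 * m + 1 with hc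
  set R : Set X := C \ ⋃ g ∈ Set.Icc (1 : ℤ) N, (e ^ (-g)) ⁻¹' U
  have hRc : IsCompact R := hC.diff (isOpen_biUnion fun g _ => hU.preimage (hcont _))
  set B : Fin (d + 1) → Set X := fun k =>
    ⋂ i ∈ Set.Icc (-(2 * m : ℤ)) (2 * m), ((e ^ (-(c k + i))) ⁻¹' closure U)ᶜ
  have hBopen : ∀ k ∈ Finset.univ, IsOpen (B k) := fun k _ =>
    (Set.finite_Icc _ _).isOpen_biInter fun i _ =>
      (isClosed_closure.preimage (hcont _)).isOpen_compl
  have hRB : R ⊆ ⋃ k ∈ Finset.univ, B k := by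
    rintro x ⟨-, hx⟩
    obtain ⟨k, hk⟩ := hfr.exists_block_notMem_closure hN hU (x := x)
      fun g hg hgU => hx (Set.mem_biUnion hg hgU)
    exact Set.mem_biUnion (Finset.mem_univ k)
      (Set.mem_iInter₂.mpr fun i hi => hk i (abs_le.mpr hi))
  obtain ⟨P, hPc, hPB, hRP⟩ := hRc.finite_compact_cover Finset.univ B hBopen hRB
  have hPC : ∀ k, P k ⊆ C := fun k x hx =>
    (hRP ▸ Set.mem_biUnion (Finset.mem_univ k) hx : x ∈ R).1
  have hPU : ∀ k, ∀ x ∈ P k, ∀ i : ℤ, |i| ≤ 2 * m → (e ^ (-(c k + i))) x ∉ closure U :=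
    fun k x hx i hi => Set.mem_iInter₂.mp (hPB k hx) i (abs_le.mp hi)
  have hcM : ∀ k, c k ∈ Set.Icc (1 : ℤ) N := by
    intro k
    have h2 : (k : ℤ) ≤ d := by have := k.isLt; omega
    have h4 : (k : ℤ) * (4 * m + 1) ≤ d * (4 * m + 1) := by gcongr
    have h5 : (0 : ℤ) ≤ k * (4 * m + 1) := by positivity
    have h6 : (N : ℤ) = d * (4 * m + 1) + (4 * m + 1) := by rw [hN]; push_cast; ring
    simp only [hc]
    constructor <;> linarith
  have hcdiff : ∀ k l, ∀ j : ℤ, j ≠ 0 → |j| ≤ 2 * m →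
      c l + (j + -c k) ≠ 0 ∧ |c l + (j + -c k)| ≤ N := by
    intro k l j hj0 hj
    have hj' := abs_le.mp hj
    have hk : (k : ℤ) ≤ d := by have := k.isLt; omega
    have hl : (l : ℤ) ≤ d := by have := l.isLt; omega
    have h4 : (k : ℤ) * (4 * m + 1) ≤ d * (4 * m + 1) := by gcongr
    have h4' : (l : ℤ) * (4 * m + 1) ≤ d * (4 * m + 1) := by gcongr
    have h5 : (0 : ℤ) ≤ k * (4 * m + 1) := by positivity
    have h5' : (0 : ℤ) ≤ l * (4 * m + 1) := by positivity
    have h6 : (N : ℤ) = d * (4 * m + 1) + (4 * m + 1) := by rw [hN]; push_cast; ring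
    simp only [hc]
    refine ⟨fun h0 => ?_, abs_le.mpr ⟨by linarith, by linarith⟩⟩
    rcases lt_trichotomy (k : ℤ) l with hlt | heq | hlt
    · nlinarith
    · rw [heq] at h0
      exact hj0 (by linarith)
    · nlinarith
  refine ⟨closure U ∪ ⋃ k, (e ^ (-c k)) '' P k,
    hUc.union (isCompact_iUnion fun k => (hPc k).image (hcont _)), ?_,
    (hLU.trans subset_closure).trans Set.subset_union_left, ?_⟩
  · rintro j ⟨hj0, hj⟩ y (hy | hy) (hy' | hy')
    · exact hUfree j ⟨hj0, hj⟩ y hy hy'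
    · obtain ⟨k, r, hr, hry⟩ := Set.mem_iUnion.mp hy'
      refine hPU k r hr j hj ?_
      rw [neg_add_rev, Equiv.Perm.zpow_add_apply, hry, ← Equiv.Perm.zpow_add_apply,
        neg_add_cancel]
      exact hy
    · obtain ⟨k, r, hr, rfl⟩ := Set.mem_iUnion.mp hy
      refine hPU k r hr (-j) (by rwa [abs_neg]) ?_
      rw [neg_add_rev, neg_neg, Equiv.Perm.zpow_add_apply]
      exact hy'
    · obtain ⟨k, r, hr, rfl⟩ := Set.mem_iUnion.mp hy
      obtain ⟨l, s, hs, hsr⟩ := Set.mem_iUnion.mp hy'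
      refine hCfree _ (hcdiff k l j hj0 hj) r (hPC k hr) ?_
      rw [e.zpow_add_apply (c l), e.zpow_add_apply j, ← hsr,
        ← e.zpow_add_apply, add_neg_cancel]
      exact hPC l hs
  · intro x hx
    by_cases hxR : x ∈ R
    · rw [hRP] at hxR
      obtain ⟨k, -, hk⟩ := Set.mem_iUnion₂.mp hxR
      refine Set.mem_biUnion (hcM k) ((e.mem_image_zpow _ _ _).mpr (Or.inr ?_))
      exact Set.mem_iUnion.mpr ⟨k, x, hk, rfl⟩
    · obtain ⟨g, hg, hgU⟩ := Set.mem_iUnion₂.mp (not_not.mp fun hn => hxR ⟨hx, hn⟩)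
      exact Set.mem_biUnion hg ((e.mem_image_zpow _ _ _).mpr (Or.inl (subset_closure hgU)))

/-- Marker lemma for `ℤ`-actions: let `h` be a homeomorphism of a locally compact metric
space `X`, let `m ≥ 1`, `N = (d+1)(4m+1)` and `M = {1, …, N} ⊆ ℤ`. If every orbit has more
than `N` points and `(X, h, ℤ)` has the `(M, d)`-small boundary property, then for every
compact `K ⊆ X` there is an open `Z ⊆ X` such that `h^{-m}(closure Z), …, h^{m}(closure Z)`
are pairwise disjoint and `K ⊆ ⋃_{i=1}^{N} h^i(Z)`. -/
theorem marker_lemma_Z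
    {X : Type*} [MetricSpace X] [LocallyCompactSpace X]
    (h : X ≃ₜ X) (m d N : ℕ) (hm : 1 ≤ m) (hN : N = (d + 1) * (4 * m + 1))
    (horbit : ∀ x : X, (N : ℕ∞) < (Set.range fun n : ℤ => (h.toEquiv ^ n) x).encard)
    (hSBP : ZSmallBoundaryProperty h.toEquiv (Set.Icc (1 : ℤ) N) d)
    (K : Set X) (hK : IsCompact K) :
    ∃ Z : Set X, IsOpen Z ∧
      (∀ i ∈ Set.Icc (-(m : ℤ)) (m : ℤ), ∀ j ∈ Set.Icc (-(m : ℤ)) (m : ℤ), i ≠ j →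
        Disjoint ((h.toEquiv ^ i) '' closure Z) ((h.toEquiv ^ j) '' closure Z)) ∧
      K ⊆ ⋃ i ∈ Set.Icc (1 : ℤ) (N : ℤ), (h.toEquiv ^ i) '' Z := by
  set e : Equiv.Perm X := h.toEquiv
  have hcover : ∀ L : Set X, IsCompact L → ReturnFree e {j : ℤ | j ≠ 0 ∧ |j| ≤ 2 * m} L →
      ∃ L' : Set X, IsCompact L' ∧ ReturnFree e {j : ℤ | j ≠ 0 ∧ |j| ≤ 2 * m} L' ∧
        L ⊆ L' ∧ K ⊆ ⋃ g ∈ Set.Icc (1 : ℤ) N, (e ^ g) '' L' := by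
    refine hK.induction_on ?_ ?_ ?_ ?_
    · exact fun L hL hLfree => ⟨L, hL, hLfree, subset_rfl, Set.empty_subset _⟩
    · intro s t hst ht L hL hLfree
      obtain ⟨L', h1, h2, h3, h4⟩ := ht L hL hLfree
      exact ⟨L', h1, h2, h3, hst.trans h4⟩
    · intro s t hs ht L hL hLfree
      obtain ⟨L₁, h1, h2, h3, h4⟩ := hs L hL hLfree
      obtain ⟨L₂, k1, k2, k3, k4⟩ := ht L₁ h1 h2
      refine ⟨L₂, k1, k2, h3.trans k3, Set.union_subset (h4.trans ?_) k4⟩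
      exact Set.iUnion₂_mono fun g _ => Set.image_mono k3
    · intro x _
      have hfree : ReturnFree e {j : ℤ | j ≠ 0 ∧ |j| ≤ N} {x} := by
        rintro j ⟨hj0, hj⟩ y rfl hjy
        have hlt : N < j.natAbs := by
          exact_mod_cast (horbit y).trans_le (e.encard_orbit_le_natAbs hj0 hjy)
        rw [Int.abs_eq_natAbs] at hj
        omega
      obtain ⟨C, hC, hxC, hCfree⟩ := ReturnFree.exists_compact_superset h
        (finite_ne_zero_abs_le N) isCompact_singleton hfree
      exact ⟨C, mem_nhdsWithin_of_mem_nhds (mem_interior_iff_mem_nhds.mp (hxC rfl)),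
        fun L hL hLfree =>
          ReturnFree.exists_compact_superset_covering h hN hSBP hC hCfree hL hLfree⟩
  obtain ⟨L, hL, hLfree, -, hKL⟩ := hcover ∅ isCompact_empty fun _ _ _ hx => hx.elim
  obtain ⟨W, hW, hLW, hWfree⟩ :=
    ReturnFree.exists_compact_superset h (finite_ne_zero_abs_le _) hL hLfree
  refine ⟨interior W, isOpen_interior, ?_,
    hKL.trans (Set.iUnion₂_mono fun g _ => Set.image_mono hLW)⟩
  intro i hi j hj hij
  have hcl : closure (interior W) ⊆ W := closure_minimal interior_subset hW.isClosed
  rw [Set.disjoint_left]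
  rintro _ ⟨a, ha, rfl⟩ hb
  rw [e.mem_image_zpow, ← Equiv.Perm.zpow_add_apply] at hb
  refine hWfree (-j + i) ⟨fun h0 => hij (by linarith), abs_le.mpr ?_⟩ a (hcl ha) (hcl hb)
  constructor <;> linarith [hi.1, hi.2, hj.1, hj.2]
end

section
/- Let X be a topological space and let h : X → X be a homeomorphism. Let d, k, m ∈ ℕ with k ≥ 1 and 2m ≥ 2(2d+3)k − d − 2 (i.e. m ≥ (2d+3)k − d/2 − 1). Let K ⊆ X be compact and suppose Z ⊆ X is an open set such that the sets h^{-m}(closure(Z)), …, h^{m}(closure(Z)) are pairwise disjoint and K ⊆ ⋃_{i=1}^{(d+1)(4m+1)} h^{i}(Z). Then there exist open subsets Z^{(0)},…,Z^{(2d+2)} ⊆ X such that (a) for every l ∈ {0,…,2d+2} the sets h^{-m}(closure(Z^{(l)})), …, h^{m}(closure(Z^{(l)})) are pairwise disjoint, and (b) K ⊆ ⋃_{l=0}^{2d+2} ⋃_{i=-(m-k)}^{m-k} h^{i}(Z^{(l)}); indeed one may take Z^{(l)} = h^{(2(m-k)+1)l + (m-k) + 1}(Z). -/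
/-- Integer powers of the permutation underlying a self-homeomorphism are homeomorphisms. -/
theorem Homeomorph.exists_toEquiv_eq_zpow {X : Type*} [TopologicalSpace X] (h : X ≃ₜ X) (n : ℤ) :
    ∃ g : X ≃ₜ X, g.toEquiv = h.toEquiv ^ n := by
  let f : (X ≃ₜ X) →* Equiv.Perm X := ⟨⟨Homeomorph.toEquiv, rfl⟩, fun _ _ => rfl⟩
  exact ⟨h ^ n, map_zpow f h n⟩

theorem Equiv.Perm.image_zpow_image_zpow {X : Type*} (f : X ≃ X) (i j : ℤ) (s : Set X) :
    (f ^ i) '' ((f ^ j) '' s) = (f ^ (i + j)) '' s := by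
  rw [zpow_add, Equiv.Perm.coe_mul, Set.image_comp]

theorem Homeomorph.isOpen_image_zpow {X : Type*} [TopologicalSpace X] (h : X ≃ₜ X) (n : ℤ)
    {s : Set X} (hs : IsOpen s) : IsOpen ((h.toEquiv ^ n) '' s) := by
  obtain ⟨g, hg⟩ := h.exists_toEquiv_eq_zpow n
  rw [← hg]
  exact g.isOpenMap s hs

theorem Homeomorph.closure_image_zpow {X : Type*} [TopologicalSpace X] (h : X ≃ₜ X) (n : ℤ)
    (s : Set X) : closure ((h.toEquiv ^ n) '' s) = (h.toEquiv ^ n) '' closure s := by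
  obtain ⟨g, hg⟩ := h.exists_toEquiv_eq_zpow n
  rw [← hg]
  exact (g.image_closure s).symm

/-- Division with remainder splits `[1, N]` into `L` blocks of length `2 * r + 1`. -/
theorem Int.exists_block_decomposition {r L N j : ℤ} (hr : 0 ≤ r) (hN : N ≤ (2 * r + 1) * L)
    (h1 : 1 ≤ j) (hj : j ≤ N) :
    ∃ l i : ℤ, 0 ≤ l ∧ l < L ∧ -r ≤ i ∧ i ≤ r ∧ i + ((2 * r + 1) * l + r + 1) = j := by
  have hpos : 0 < 2 * r + 1 := by lia
  have hdiv := Int.mul_ediv_add_emod (j - 1) (2 * r + 1)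
  have hlo := Int.emod_nonneg (j - 1) hpos.ne'
  have hhi := Int.emod_lt_of_pos (j - 1) hpos
  refine ⟨(j - 1) / (2 * r + 1), (j - 1) % (2 * r + 1) - r, Int.ediv_nonneg (by lia) hpos.le,
    Int.ediv_lt_of_lt_mul hpos (by linarith), by lia, by lia, by linarith⟩


/-- Splitting a marker set into towers: let `h` be a homeomorphism of a topological space
`X`, `k ≥ 1` and `2m + d + 2 ≥ 2(2d+3)k` (i.e. `m ≥ (2d+3)k − d/2 − 1`). If `Z` is an open
set whose iterates `h^{-m}(closure Z), …, h^{m}(closure Z)` are pairwise disjoint and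
`K ⊆ ⋃_{i=1}^{(d+1)(4m+1)} h^i(Z)` for a compact set `K`, then the open sets
`Z^(l) = h^{(2(m-k)+1)l + (m-k) + 1}(Z)`, `l = 0, …, 2d+2`, satisfy: each family
`h^{-m}(closure Z^(l)), …, h^{m}(closure Z^(l))` is pairwise disjoint and
`K ⊆ ⋃_{l=0}^{2d+2} ⋃_{i=-(m-k)}^{m-k} h^i(Z^(l))`. -/
theorem marker_towers
    {X : Type*} [TopologicalSpace X] (h : X ≃ₜ X) (d k m : ℕ)
    (hk : 1 ≤ k) (hm : 2 * (2 * d + 3) * k ≤ 2 * m + d + 2)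
    (K : Set X) (hK : IsCompact K) (Z : Set X) (hZ : IsOpen Z)
    (hdisj : ∀ i ∈ Set.Icc (-(m : ℤ)) (m : ℤ), ∀ j ∈ Set.Icc (-(m : ℤ)) (m : ℤ), i ≠ j →
      Disjoint ((h.toEquiv ^ i) '' closure Z) ((h.toEquiv ^ j) '' closure Z))
    (hcover : K ⊆ ⋃ i ∈ Set.Icc (1 : ℤ) (((d : ℤ) + 1) * (4 * (m : ℤ) + 1)),
      (h.toEquiv ^ i) '' Z) :
    ∃ Zl : Fin (2 * d + 3) → Set X,
      (∀ l : Fin (2 * d + 3), Zl l =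
        (h.toEquiv ^ ((2 * ((m : ℤ) - (k : ℤ)) + 1) * (l : ℤ) + ((m : ℤ) - (k : ℤ)) + 1))
          '' Z) ∧
      (∀ l, IsOpen (Zl l)) ∧
      (∀ l, ∀ i ∈ Set.Icc (-(m : ℤ)) (m : ℤ), ∀ j ∈ Set.Icc (-(m : ℤ)) (m : ℤ), i ≠ j →
        Disjoint ((h.toEquiv ^ i) '' closure (Zl l)) ((h.toEquiv ^ j) '' closure (Zl l))) ∧
      K ⊆ ⋃ l : Fin (2 * d + 3),
        ⋃ i ∈ Set.Icc (-((m : ℤ) - (k : ℤ))) ((m : ℤ) - (k : ℤ)), (h.toEquiv ^ i) '' Zl l := by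
  have hr : (0 : ℤ) ≤ (m : ℤ) - k := by
    have : k ≤ m := by nlinarith [Nat.mul_le_mul_left d hk]
    lia
  have hN : ((d : ℤ) + 1) * (4 * (m : ℤ) + 1) ≤
      (2 * ((m : ℤ) - k) + 1) * (2 * (d : ℤ) + 3) := by
    zify at hm
    linarith
  refine ⟨fun l => _, fun l => rfl, fun l => h.isOpen_image_zpow _ hZ, ?_, ?_⟩
  · intro l i hi j hj hij
    simp only [h.closure_image_zpow, Equiv.Perm.image_zpow_image_zpow]
    rw [add_comm i, add_comm j, ← Equiv.Perm.image_zpow_image_zpow _ _ i,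
      ← Equiv.Perm.image_zpow_image_zpow _ _ j, Set.disjoint_image_iff (Equiv.injective _)]
    exact hdisj i hi j hj hij
  · intro x hx
    have hx' := hcover hx
    simp only [Set.mem_iUnion₂] at hx'
    obtain ⟨j, hj, hxj⟩ := hx'
    obtain ⟨l, i, hl0, hlL, hi, hi', rfl⟩ := Int.exists_block_decomposition hr hN hj.1 hj.2
    lift l to ℕ using hl0
    refine Set.mem_iUnion.2 ⟨⟨l, by lia⟩, Set.mem_iUnion₂.2 ⟨i, ⟨hi, hi'⟩, ?_⟩⟩
    rwa [Equiv.Perm.image_zpow_image_zpow]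
end
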